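/- Let D = A ⋈ H be a double cross product of finite-dimensional Hopf algebras. If D is unimodular (its left and right integral spaces coincide), then there is a nonzero scalar x with Λ_D = x (Λ_A^l ⊗ Λ_H^r), and D is semisimple if and only if both A and H are semisimple. -/

import Mathlib

open TensorProduct

/-- `Λ` is a left integral in the Hopf algebra `H`: `x Λ = ε(x) Λ` for all `x`. -/
def IsLeftIntegral (k : Type*) {H : Type*} [CommRing k] [Ring H] [HopfAlgebra k H]
    (Λ : H) : Prop :=
  ∀ x : H, x * Λ = Coalgebra.counit (R := k) x • Λ

/-- `Λ` is a right integral in the Hopf algebra `H`: `Λ x = ε(x) Λ` for all `x`. -/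
def IsRightIntegral (k : Type*) {H : Type*} [CommRing k] [Ring H] [HopfAlgebra k H]
    (Λ : H) : Prop :=
  ∀ x : H, Λ * x = Coalgebra.counit (R := k) x • Λ

open Coalgebra HopfAlgebra WithConv

section HopfAlgebra

variable {k A : Type*} [Field k] [Ring A] [HopfAlgebra k A]

lemma convMul_includeLeft_includeRight :
    toConv (Algebra.TensorProduct.includeLeft (R := k) (S := k) (A := A) (B := A)).toLinearMap *
      toConv (Algebra.TensorProduct.includeRight (R := k) (A := A) (B := A)).toLinearMap =
      toConv (comul (R := k) (A := A)) := by
  ext a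
  rw [(ℛ k a).convMul_apply]
  simp [(ℛ k a).eq]

lemma convMul_antipode_tmul_one_comul :
    toConv ((Algebra.TensorProduct.includeLeft (R := k) (S := k) (A := A) (B := A)).toLinearMap ∘ₗ
        antipode k) * toConv (comul (R := k) (A := A)) =
      toConv (Algebra.TensorProduct.includeRight (R := k) (A := A) (B := A)).toLinearMap := by
  rw [← convMul_includeLeft_includeRight, ← mul_assoc]
  have h := LinearMap.algHom_comp_convMul_distrib
    (Algebra.TensorProduct.includeLeft (R := k) (S := k) (A := A) (B := A))
    (toConv (antipode k (A := A))) (toConv LinearMap.id)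
  rw [LinearMap.antipode_mul_id] at h
  have h' : toConv ((Algebra.TensorProduct.includeLeft (R := k) (S := k) (A := A)
      (B := A)).toLinearMap ∘ₗ antipode k) *
      toConv (Algebra.TensorProduct.includeLeft (R := k) (S := k) (A := A) (B := A)).toLinearMap =
      1 := by
    apply WithConv.ofConv_injective
    refine h.symm.trans ?_
    ext a
    simp [LinearMap.convOne_def, Algebra.TensorProduct.algebraMap_apply]
  rw [h', one_mul]

namespace IsLeftIntegral

variable {Λ : A}

/-- In Sweedler notation, `S(h) Λ₁ ⊗ Λ₂ = Λ₁ ⊗ h Λ₂`. -/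
lemma antipode_tmul_one_mul_comul (hΛ : IsLeftIntegral k Λ) (h : A) :
    (antipode k h ⊗ₜ[k] (1 : A)) * comul Λ = ((1 : A) ⊗ₜ[k] h) * comul Λ := by
  have key := congr($(convMul_antipode_tmul_one_comul (k := k) (A := A)) h)
  rw [(ℛ k h).convMul_apply] at key
  have key' := congr($key * comul (R := k) Λ)
  simp only [Finset.sum_mul, mul_assoc] at key'
  simp only [LinearMap.coe_comp, Function.comp_apply, ← Bialgebra.comul_mul,
    hΛ _, map_smul, mul_smul_comm] at key'
  have hS : ∑ i ∈ (ℛ k h).index, counit (R := k) ((ℛ k h).right i) • (ℛ k h).left i = h := by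
    simpa [-sum_tmul_counit_eq] using congr(TensorProduct.rid k A $(sum_tmul_counit_eq (ℛ k h)))
  conv_lhs => rw [← hS]
  simpa [TensorProduct.sum_tmul, Finset.sum_mul, ← TensorProduct.smul_tmul'] using key'

/-- In Sweedler notation, `φ(S(h) Λ₁) Λ₂ = h φ(Λ₁) Λ₂`. -/
lemma lid_rTensor_antipode_comul (hΛ : IsLeftIntegral k Λ) (φ : A →ₗ[k] k) (h : A) :
    TensorProduct.lid k A
        ((φ ∘ₗ LinearMap.mulLeft k (antipode k h)).rTensor A (comul Λ)) =
      h * TensorProduct.lid k A (φ.rTensor A (comul Λ)) := by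
  have left (a : A) (z : A ⊗[k] A) :
      TensorProduct.lid k A ((φ ∘ₗ LinearMap.mulLeft k a).rTensor A z) =
        TensorProduct.lid k A (φ.rTensor A ((a ⊗ₜ[k] (1 : A)) * z)) := by
    induction z with
    | zero => simp
    | tmul x y => simp
    | add x y hx hy => simp [mul_add, hx, hy]
  have right (z : A ⊗[k] A) :
      TensorProduct.lid k A (φ.rTensor A (((1 : A) ⊗ₜ[k] h) * z)) =
        h * TensorProduct.lid k A (φ.rTensor A z) := by
    induction z with
    | zero => simp
    | tmul x y => simp
    | add x y hx hy => simp [mul_add, hx, hy]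
  rw [left, hΛ.antipode_tmul_one_mul_comul, right]

/-- A nonzero left integral `Λ` admits a functional `φ` with `φ(Λ₁) Λ₂ = 1`. -/
lemma exists_lid_rTensor_comul_eq_one (hΛ : IsLeftIntegral k Λ) (hΛ0 : Λ ≠ 0) :
    ∃ φ : A →ₗ[k] k, TensorProduct.lid k A (φ.rTensor A (comul Λ)) = 1 := by
  obtain ⟨ψ, hψ⟩ := Module.Projective.exists_dual_ne_zero k hΛ0
  set θ := toConv (Algebra.linearMap k A ∘ₗ ψ) * toConv (antipode k (A := A)) with hθ
  have hθΛ := congr($(show θ * toConv LinearMap.id = toConv (Algebra.linearMap k A ∘ₗ ψ) by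
    rw [hθ, mul_assoc, LinearMap.antipode_mul_id, mul_one]) Λ)
  let b := Module.Basis.ofVectorSpace k A
  obtain ⟨c, hc⟩ := TensorProduct.eq_repr_basis_left b (comul (R := k) Λ)
  have hcoord (i) : TensorProduct.lid k A ((b.coord i).rTensor A (comul Λ)) = c i := by
    classical
    simpa [← hc, Finsupp.sum, Finsupp.single_apply, ite_smul] using Eq.symm
  refine ⟨(ψ Λ)⁻¹ • ∑ i ∈ c.support, b.coord i ∘ₗ LinearMap.mulLeft k (antipode k (θ (b i))), ?_⟩
  have hsum : ∑ i ∈ c.support, θ (b i) * c i = algebraMap k A (ψ Λ) := by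
    simpa [← hc, Finsupp.sum] using hθΛ
  have hadd : (∑ i ∈ c.support, b.coord i ∘ₗ
      LinearMap.mulLeft k (antipode k (θ (b i)))).rTensor A = ∑ i ∈ c.support,
        (b.coord i ∘ₗ LinearMap.mulLeft k (antipode k (θ (b i)))).rTensor A :=
    map_sum (LinearMap.rTensorHom A) _ _
  rw [LinearMap.rTensor_smul, hadd, LinearMap.smul_apply, LinearMap.sum_apply, map_smul, map_sum]
  simp_rw [hΛ.lid_rTensor_antipode_comul, hcoord]
  rw [hsum, Algebra.algebraMap_eq_smul_one, smul_smul, inv_mul_cancel₀ hψ, one_smul]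

lemma antipode_injective (hΛ : IsLeftIntegral k Λ) (hΛ0 : Λ ≠ 0) :
    Function.Injective (antipode k (A := A)) := by
  obtain ⟨φ, hφ⟩ := hΛ.exists_lid_rTensor_comul_eq_one hΛ0
  rw [injective_iff_map_eq_zero]
  intro h hh
  have := hΛ.lid_rTensor_antipode_comul φ h
  rw [hh, hφ, mul_one] at this
  simpa using this.symm

lemma antipode_bijective [FiniteDimensional k A] (hΛ : IsLeftIntegral k Λ) (hΛ0 : Λ ≠ 0) :
    Function.Bijective (antipode k (A := A)) :=
  ⟨hΛ.antipode_injective hΛ0,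
    LinearMap.injective_iff_surjective.mp (hΛ.antipode_injective hΛ0)⟩

/-- Left integrals in a finite-dimensional Hopf algebra are unique up to a scalar. -/
lemma exists_eq_smul [FiniteDimensional k A] (hΛ : IsLeftIntegral k Λ) (hΛ0 : Λ ≠ 0) {t : A}
    (ht : IsLeftIntegral k t) : ∃ x : k, t = x • Λ := by
  obtain ⟨φ, hφ⟩ := hΛ.exists_lid_rTensor_comul_eq_one hΛ0
  have hSt (x : A) : antipode k t * x = counit (R := k) x • antipode k t := by
    obtain ⟨y, rfl⟩ := (hΛ.antipode_bijective hΛ0).surjective x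
    rw [← antipode_mul_antidistrib, ht, map_smul, counit_antipode]
  have hcomp : φ ∘ₗ LinearMap.mulLeft k (antipode k t) = φ (antipode k t) • counit := by
    ext x
    simp [hSt, mul_comm]
  refine ⟨φ (antipode k t), ?_⟩
  have := hΛ.lid_rTensor_antipode_comul φ t
  rw [hφ, mul_one, hcomp, LinearMap.rTensor_smul] at this
  simpa using this.symm

/-- A tensor in `A ⊗ V` on which `A` acts through the counit is `Λ ⊗ v` for some `v`. -/
lemma exists_eq_tmul [FiniteDimensional k A] (hΛ : IsLeftIntegral k Λ) (hΛ0 : Λ ≠ 0)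
    {V : Type*} [AddCommGroup V] [Module k V] {t : A ⊗[k] V}
    (ht : ∀ a : A, (LinearMap.mulLeft k a).rTensor V t = counit (R := k) a • t) :
    ∃ v : V, t = Λ ⊗ₜ[k] v := by
  let b := Module.Basis.ofVectorSpace k V
  obtain ⟨c, hc⟩ := TensorProduct.eq_repr_basis_right b t
  have hcoord (i) : TensorProduct.rid k A ((b.coord i).lTensor A t) = c i := by
    classical
    simpa [← hc, Finsupp.sum, Finsupp.single_apply, ite_smul] using Eq.symm
  have hint (i) : IsLeftIntegral k (c i) := by
    intro a
    have comm (z : A ⊗[k] V) : TensorProduct.rid k A ((b.coord i).lTensor A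
        ((LinearMap.mulLeft k a).rTensor V z)) =
        a * TensorProduct.rid k A ((b.coord i).lTensor A z) := by
      induction z with
      | zero => simp
      | tmul x y => simp
      | add x y hx hy => simp [mul_add, hx, hy]
    rw [← hcoord, ← comm, ht, map_smul, map_smul]
  choose x hx using fun i ↦ hΛ.exists_eq_smul hΛ0 (hint i)
  refine ⟨∑ i ∈ c.support, x i • b i, ?_⟩
  rw [← hc, Finsupp.sum, TensorProduct.tmul_sum]
  exact Finset.sum_congr rfl fun i _ ↦ by
    rw [TensorProduct.tmul_smul, TensorProduct.smul_tmul', ← hx]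

/-- **Maschke's theorem**: a Hopf algebra with a left integral of nonzero counit is semisimple. -/
lemma isSemisimpleRing_of_counit_ne_zero [FiniteDimensional k A] (hΛ : IsLeftIntegral k Λ)
    (hε : counit (R := k) Λ ≠ 0) : IsSemisimpleRing A := by
  have hΛ0 : Λ ≠ 0 := by rintro rfl; simp at hε
  let S := LinearEquiv.ofBijective (antipode k (A := A)) (hΛ.antipode_bijective hΛ0)
  have S_mul (a b : A) : S (a * b) = S b * S a := antipode_mul_antidistrib a b
  have S_symm_mul (a b : A) : S.symm (a * b) = S.symm b * S.symm a :=
    S.injective (by simp [S_mul])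
  refine (isSemisimpleModule_iff A A).mpr ⟨fun N ↦ ?_⟩
  obtain ⟨p, hp⟩ := LinearMap.exists_leftInverse_of_injective (N.restrictScalars k).subtype
    (LinearMap.ker_eq_bot.mpr Subtype.val_injective)
  let p : A →ₗ[k] N := p
  have hp (n : N) : p n = n := congr($hp n)
  let G : A ⊗[k] A →ₗ[k] A →ₗ[k] N := TensorProduct.lift <| LinearMap.mk₂ k
    (fun a b ↦ Algebra.lsmul k k N b ∘ₗ p ∘ₗ LinearMap.mulLeft k (S.symm a))
    (by intros; ext; simp [add_mul]) (by intros; ext; simp)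
    (by intros; ext; simp) (by intros; ext; simp)
  have G_tmul (a b x : A) : G (a ⊗ₜ b) x = b • p (S.symm a * x) := rfl
  have G_left (a : A) (z : A ⊗[k] A) (x : A) :
      G ((S a ⊗ₜ[k] (1 : A)) * z) x = G z (a * x) := by
    induction z with
    | zero => simp
    | tmul y z => simp [G_tmul, S_symm_mul, mul_assoc]
    | add y z hy hz => simp [mul_add, hy, hz]
  have G_right (a : A) (z : A ⊗[k] A) (x : A) :
      G (((1 : A) ⊗ₜ[k] a) * z) x = a • G z x := by
    induction z with
    | zero => simp
    | tmul y z => simp [G_tmul, mul_smul]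
    | add y z hy hz => simp [mul_add, hy, hz]
  have G_proj (z : A ⊗[k] A) (n : N) :
      S ((G z n : N) : A) = S n * LinearMap.mul' k A ((antipode k).lTensor A z) := by
    induction z with
    | zero => simp
    | tmul y z =>
      have := hp (S.symm y • n)
      rw [Submodule.coe_smul, smul_eq_mul] at this
      rw [G_tmul, this]
      simp [S_mul, mul_assoc]
      rfl
    | add y z hy hz => simp [mul_add, hy, hz]
  let P : A →ₗ[A] N :=
    { toFun := fun x ↦ (counit (R := k) Λ)⁻¹ • G (comul Λ) x
      map_add' := by simp
      map_smul' := by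
        intro a x
        have : G (comul Λ) (a * x) = a • G (comul Λ) x := by
          rw [← G_left, ← G_right]
          exact congr(G $(hΛ.antipode_tmul_one_mul_comul a) x)
        change (counit (R := k) Λ)⁻¹ • G (comul Λ) (a * x) = a • (counit (R := k) Λ)⁻¹ • _
        rw [this, smul_comm] }
  refine ⟨LinearMap.ker P, LinearMap.isCompl_of_proj (f := P) fun n ↦ ?_⟩
  have : G (comul Λ) n = counit (R := k) Λ • n := by
    apply Subtype.val_injective
    apply S.injective
    rw [G_proj, mul_antipode_lTensor_comul_apply]
    simp [Algebra.algebraMap_eq_smul_one]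
  change (counit (R := k) Λ)⁻¹ • G (comul Λ) n = n
  rw [this, smul_smul, inv_mul_cancel₀ hε, one_smul]

lemma counit_ne_zero [FiniteDimensional k A] [IsSemisimpleRing A] (hΛ : IsLeftIntegral k Λ)
    (hΛ0 : Λ ≠ 0) : counit (R := k) Λ ≠ 0 := by
  let I : Submodule A A := RingHom.ker (Bialgebra.counitAlgHom k A)
  have mem_I (a : A) : a ∈ I ↔ counit (R := k) a = 0 := Iff.rfl
  obtain ⟨J, hJ⟩ := exists_isCompl I
  obtain ⟨i, hi, e, he, hie⟩ :=
    Submodule.mem_sup.mp (hJ.sup_eq_top ▸ Submodule.mem_top (x := (1 : A)))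
  have hεe : counit (R := k) e = 1 := by
    simpa [(mem_I i).mp hi] using congr(counit (R := k) $hie)
  have he_int : IsLeftIntegral k e := fun x ↦ by
    rw [← sub_eq_zero]
    refine Submodule.disjoint_def.mp hJ.disjoint _ ((mem_I _).mpr ?_) ?_
    · simp [hεe]
    · exact J.sub_mem (J.smul_mem x he) (J.smul_of_tower_mem _ he)
  obtain ⟨x, hx⟩ := hΛ.exists_eq_smul hΛ0 he_int
  rintro h
  simp [hx, h] at hεe

/-- A finite-dimensional Hopf algebra is semisimple iff its nonzero left integrals have nonzero
counit. -/
lemma isSemisimpleRing_iff [FiniteDimensional k A] (hΛ : IsLeftIntegral k Λ) (hΛ0 : Λ ≠ 0) :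
    IsSemisimpleRing A ↔ counit (R := k) Λ ≠ 0 :=
  ⟨fun _ ↦ hΛ.counit_ne_zero hΛ0, hΛ.isSemisimpleRing_of_counit_ne_zero⟩

end IsLeftIntegral

section OpCop

variable (k A)

/-- The opposite ring with the co-opposite coalgebra structure. -/
noncomputable abbrev opCopCoalgebra : Coalgebra k Aᵐᵒᵖ where
  comul := (TensorProduct.comm k _ _).toLinearMap ∘ₗ comul
  counit := counit
  coassoc := by
    let Δ : Aᵐᵒᵖ →ₗ[k] Aᵐᵒᵖ ⊗[k] Aᵐᵒᵖ := comul
    let σ := (TensorProduct.comm k Aᵐᵒᵖ Aᵐᵒᵖ).toLinearMap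
    let P : Aᵐᵒᵖ ⊗[k] (Aᵐᵒᵖ ⊗[k] Aᵐᵒᵖ) →ₗ[k] Aᵐᵒᵖ ⊗[k] (Aᵐᵒᵖ ⊗[k] Aᵐᵒᵖ) :=
      (TensorProduct.assoc k _ _ _).toLinearMap ∘ₗ
        (TensorProduct.comm k _ _).toLinearMap ∘ₗ σ.lTensor Aᵐᵒᵖ
    have left : (TensorProduct.assoc k _ _ _).toLinearMap ∘ₗ (σ ∘ₗ Δ).rTensor Aᵐᵒᵖ ∘ₗ σ =
        P ∘ₗ Δ.lTensor Aᵐᵒᵖ := by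
      ext x y
      simp [P, σ]
    have right : (σ ∘ₗ Δ).lTensor Aᵐᵒᵖ ∘ₗ σ =
        P ∘ₗ (TensorProduct.assoc k _ _ _).toLinearMap ∘ₗ Δ.rTensor Aᵐᵒᵖ := by
      refine TensorProduct.ext' fun x y ↦ ?_
      have (z : Aᵐᵒᵖ ⊗[k] Aᵐᵒᵖ) :
          y ⊗ₜ[k] σ z = P (TensorProduct.assoc k _ _ _ (z ⊗ₜ[k] y)) := by
        induction z with
        | zero => simp
        | tmul u v => simp [P, σ]
        | add u v hu hv => simp [TensorProduct.tmul_add, TensorProduct.add_tmul, hu, hv]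
      simpa [σ] using this (Δ x)
    ext1 a
    have h₁ := congr($left (Δ a))
    have h₂ := congr($right (Δ a))
    simp only [LinearMap.comp_apply, LinearEquiv.coe_coe] at h₁ h₂
    rw [coassoc_apply] at h₂
    exact h₁.trans h₂.symm
  rTensor_counit_comp_comul := by
    ext1 a
    have h (z : Aᵐᵒᵖ ⊗[k] Aᵐᵒᵖ) : (counit (R := k)).rTensor Aᵐᵒᵖ (TensorProduct.comm k _ _ z) =
        TensorProduct.comm k _ _ ((counit (R := k)).lTensor Aᵐᵒᵖ z) :=
      congr($(LinearMap.rTensor_comp_comm _) z)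
    simp [h]
  lTensor_counit_comp_comul := by
    ext1 a
    have h (z : Aᵐᵒᵖ ⊗[k] Aᵐᵒᵖ) : (counit (R := k)).lTensor Aᵐᵒᵖ (TensorProduct.comm k _ _ z) =
        TensorProduct.comm k _ _ ((counit (R := k)).rTensor Aᵐᵒᵖ z) :=
      congr($(LinearMap.lTensor_comp_comm _) z)
    simp [h]

/-- The co-opposite Hopf algebra structure on the opposite ring. -/
noncomputable abbrev opCopHopfAlgebra : HopfAlgebra k Aᵐᵒᵖ :=
  letI B : Bialgebra k Aᵐᵒᵖ := @Bialgebra.mk' k Aᵐᵒᵖ _ _ _ (opCopCoalgebra k A)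
    (Bialgebra.counit_one (R := k) (A := A))
    (fun {a b} ↦ (Bialgebra.counit_mul (R := k) b.unop a.unop).trans (mul_comm _ _))
    (by
      change TensorProduct.comm k _ _ (comul 1) = 1
      simp [MulOpposite.comul_def, Algebra.TensorProduct.one_def])
    (by
      intro a b
      change TensorProduct.comm k _ _ (comul (a * b)) =
        TensorProduct.comm k _ _ (comul a) * TensorProduct.comm k _ _ (comul b)
      simp only [MulOpposite.comul_def, LinearMap.comp_apply, LinearEquiv.coe_coe,
        MulOpposite.coe_opLinearEquiv_symm, MulOpposite.unop_mul, Bialgebra.comul_mul]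
      generalize comul (R := k) a.unop = x
      generalize comul (R := k) b.unop = y
      induction x with
      | zero => simp
      | add x x' hx hx' => simp [mul_add, add_mul, hx, hx']
      | tmul x x' =>
        induction y with
        | zero => simp
        | add y y' hy hy' => simp [mul_add, add_mul, hy, hy']
        | tmul y y' => simp)
  { antipode := (MulOpposite.opLinearEquiv k).toLinearMap ∘ₗ antipode k ∘ₗ
      (MulOpposite.opLinearEquiv k).symm.toLinearMap
    mul_antipode_rTensor_comul := by
      ext1 a
      have h (z : A ⊗[k] A) : LinearMap.mul' k Aᵐᵒᵖ (((MulOpposite.opLinearEquiv k).toLinearMap ∘ₗ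
          antipode k ∘ₗ (MulOpposite.opLinearEquiv k).symm.toLinearMap).rTensor Aᵐᵒᵖ
          (TensorProduct.comm k _ _ (TensorProduct.map (MulOpposite.opLinearEquiv k).toLinearMap
            (MulOpposite.opLinearEquiv k).toLinearMap z))) =
          MulOpposite.op (LinearMap.mul' k A ((antipode k).lTensor A z)) := by
        induction z with
        | zero => simp
        | add x y hx hy => simp [hx, hy]
        | tmul x y => simp
      exact (h (comul a.unop)).trans
        congr(MulOpposite.op $(mul_antipode_lTensor_comul_apply (R := k) a.unop))
    mul_antipode_lTensor_comul := by
      ext1 a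
      have h (z : A ⊗[k] A) : LinearMap.mul' k Aᵐᵒᵖ (((MulOpposite.opLinearEquiv k).toLinearMap ∘ₗ
          antipode k ∘ₗ (MulOpposite.opLinearEquiv k).symm.toLinearMap).lTensor Aᵐᵒᵖ
          (TensorProduct.comm k _ _ (TensorProduct.map (MulOpposite.opLinearEquiv k).toLinearMap
            (MulOpposite.opLinearEquiv k).toLinearMap z))) =
          MulOpposite.op (LinearMap.mul' k A ((antipode k).rTensor A z)) := by
        induction z with
        | zero => simp
        | add x y hx hy => simp [hx, hy]
        | tmul x y => simp
      exact (h (comul a.unop)).trans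
        congr(MulOpposite.op $(mul_antipode_rTensor_comul_apply (R := k) a.unop)) }

end OpCop

namespace IsRightIntegral

variable {Λ : A}

lemma isLeftIntegral_op (hΛ : IsRightIntegral k Λ) :
    letI := opCopHopfAlgebra k A
    IsLeftIntegral k (MulOpposite.op Λ) :=
  fun x ↦ congr(MulOpposite.op $(hΛ x.unop))

/-- Right integrals in a finite-dimensional Hopf algebra are unique up to a scalar. -/
lemma exists_eq_smul [FiniteDimensional k A] (hΛ : IsRightIntegral k Λ) (hΛ0 : Λ ≠ 0) {t : A}
    (ht : IsRightIntegral k t) : ∃ x : k, t = x • Λ := by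
  let := opCopHopfAlgebra k A
  obtain ⟨x, hx⟩ := hΛ.isLeftIntegral_op.exists_eq_smul
    ((MulOpposite.op_ne_zero_iff Λ).mpr hΛ0) ht.isLeftIntegral_op
  exact ⟨x, MulOpposite.op_injective hx⟩

/-- A finite-dimensional Hopf algebra is semisimple iff its nonzero right integrals have nonzero
counit. -/
lemma isSemisimpleRing_iff [FiniteDimensional k A] (hΛ : IsRightIntegral k Λ) (hΛ0 : Λ ≠ 0) :
    IsSemisimpleRing A ↔ counit (R := k) Λ ≠ 0 := by
  let := opCopHopfAlgebra k A
  rw [← isSemisimpleRing_mulOpposite_iff]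
  exact hΛ.isLeftIntegral_op.isSemisimpleRing_iff ((MulOpposite.op_ne_zero_iff Λ).mpr hΛ0)

end IsRightIntegral

end HopfAlgebra

/-- Let `D = A ⋈ H` be a double cross product of finite-dimensional Hopf algebras.  If
`D` is unimodular (its left and right integral spaces coincide), then any nonzero left
integral `Λ_D` equals `x (Λ_A^l ⊗ Λ_H^r)` for some nonzero scalar `x`, and `D` is
semisimple if and only if both `A` and `H` are semisimple. -/
theorem unimodular_double_cross_product (k A H D : Type*) [Field k]
    [Ring A] [HopfAlgebra k A] [Ring H] [HopfAlgebra k H] [Ring D] [HopfAlgebra k D]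
    [FiniteDimensional k A] [FiniteDimensional k H] [FiniteDimensional k D]
    (f : (A ⊗[k] H) ≃ₗ[k] D)
    (hone : f (1 ⊗ₜ 1) = 1)
    (hmulA : ∀ (a a' : A) (h : H), f (a ⊗ₜ 1) * f (a' ⊗ₜ h) = f ((a * a') ⊗ₜ h))
    (hmulH : ∀ (a : A) (h h' : H), f (a ⊗ₜ h) * f (1 ⊗ₜ h') = f (a ⊗ₜ (h * h')))
    (hcounit : ∀ x : A ⊗[k] H,
      Coalgebra.counit (R := k) (f x) = Coalgebra.counit (R := k) x)
    (hunimodular : ∀ Λ : D, IsLeftIntegral k Λ ↔ IsRightIntegral k Λ)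
    (ΛA : A) (hΛA : IsLeftIntegral k ΛA) (hΛA0 : ΛA ≠ 0)
    (ΛH : H) (hΛH : IsRightIntegral k ΛH) (hΛH0 : ΛH ≠ 0)
    (ΛD : D) (hΛD : IsLeftIntegral k ΛD) (hΛD0 : ΛD ≠ 0) :
    (∃ x : k, x ≠ 0 ∧ ΛD = x • f (ΛA ⊗ₜ ΛH)) ∧
    (IsSemisimpleRing D ↔ IsSemisimpleRing A ∧ IsSemisimpleRing H) := by
  have hfA (a : A) (t : A ⊗[k] H) :
      f (a ⊗ₜ 1) * f t = f ((LinearMap.mulLeft k a).rTensor H t) := by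
    induction t with
    | zero => simp
    | tmul x y => simpa using hmulA a x y
    | add x y hx hy => simp [mul_add, hx, hy]
  obtain ⟨v, hv⟩ : ∃ v : H, f.symm ΛD = ΛA ⊗ₜ v := by
    refine hΛA.exists_eq_tmul hΛA0 fun a ↦ f.injective ?_
    rw [← hfA, f.apply_symm_apply, hΛD, hcounit, map_smul, f.apply_symm_apply]
    simp
  rw [f.symm_apply_eq] at hv
  have hvint : IsRightIntegral k v := by
    intro h
    have h₁ : f (ΛA ⊗ₜ (v * h)) = f (ΛA ⊗ₜ (counit (R := k) h • v)) := by
      rw [← hmulH, ← hv, (hunimodular ΛD).mp hΛD, hcounit, TensorProduct.tmul_smul, map_smul, ← hv]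
      simp
    obtain ⟨φ, hφ⟩ := Module.Projective.exists_dual_ne_zero k hΛA0
    have h₂ := congr(TensorProduct.lid k H (LinearMap.rTensor H φ $(f.injective h₁)))
    simp only [LinearMap.rTensor_tmul, TensorProduct.lid_tmul] at h₂
    exact smul_right_injective H hφ h₂
  obtain ⟨x, rfl⟩ := hΛH.exists_eq_smul hΛH0 hvint
  rw [TensorProduct.tmul_smul, map_smul] at hv
  have hx : x ≠ 0 := by
    rintro rfl
    exact hΛD0 (by rw [hv, zero_smul])
  refine ⟨⟨x, hx, hv⟩, ?_⟩
  rw [hΛD.isSemisimpleRing_iff hΛD0, hΛA.isSemisimpleRing_iff hΛA0,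
    hΛH.isSemisimpleRing_iff hΛH0, hv, map_smul, hcounit, TensorProduct.counit_tmul]
  simp [hx, and_comm]
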